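/- arXiv:2406.18307 — 2 statements merged into one kernel-verified Lean document; each statement's English description precedes it below -/
import Mathlib

section
/- Let m ≥ 2 be odd. For s, t ∈ 𝔽_q let N(s,t) = #{(α,β) ∈ 𝔽_{q^m} × 𝔽_{q^m} : Tr(α²) = s and Tr(β²) = t}. Then, as identities of complex numbers: N(0,0) = q^{2m−2}; for s ≠ 0, N(s,0) = q^{2m−2} + q^{m−2}·η̄(−s)·G·Ḡ; for t ≠ 0, N(0,t) = q^{2m−2} + q^{m−2}·η̄(−t)·G·Ḡ; and for s ≠ 0 and t ≠ 0, N(s,t) = q^{2m−2} + q^{m−2}·(η̄(−s) + η̄(−t))·G·Ḡ + q^{−2}·η̄(st)·G²·Ḡ². -/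
open Finset

/-- The additive character `s ↦ exp(2πi·s̃/q)` of `ZMod q`. -/
noncomputable def zetaQ (q : ℕ) (s : ZMod q) : ℂ :=
  Complex.exp (2 * Real.pi * Complex.I * (s.val : ℂ) / (q : ℂ))

/-- The quadratic Gauss sum `G` over the big field `F`. -/
noncomputable def gaussBig (q : ℕ) [Fact q.Prime] (F : Type*) [Field F] [Fintype F]
    [DecidableEq F] [Algebra (ZMod q) F] : ℂ :=
  ∑ x ∈ Finset.univ.filter (fun x : F => x ≠ 0),
    (quadraticChar F x : ℂ) * zetaQ q (Algebra.trace (ZMod q) F x)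

/-- The quadratic Gauss sum `Ḡ` over the prime field `ZMod q`. -/
noncomputable def gaussSmall (q : ℕ) [Fact q.Prime] : ℂ :=
  ∑ y ∈ Finset.univ.filter (fun y : ZMod q => y ≠ 0),
    (quadraticChar (ZMod q) y : ℂ) * zetaQ q y

/-- `N(s,t) = #{(α,β) : Tr(α²) = s, Tr(β²) = t}`. -/
noncomputable def Ncount (q : ℕ) (F : Type*) [Field F] [Fintype F] [Algebra (ZMod q) F]
    (s t : ZMod q) : ℕ :=
  Nat.card {p : F × F // Algebra.trace (ZMod q) F (p.1 ^ 2) = s ∧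
    Algebra.trace (ZMod q) F (p.2 ^ 2) = t}

theorem zetaQ_eq_stdAddChar (q : ℕ) [NeZero q] (s : ZMod q) :
    zetaQ q s = ZMod.stdAddChar s := by
  rw [zetaQ, ZMod.stdAddChar_apply, ZMod.toCircle_apply]

theorem gaussSmall_eq_gaussSum (q : ℕ) [Fact q.Prime] : gaussSmall q =
    gaussSum ((quadraticChar (ZMod q)).ringHomComp (Int.castRingHom ℂ)) ZMod.stdAddChar := by
  simp only [gaussSmall, gaussSum, zetaQ_eq_stdAddChar]
  refine Finset.sum_filter_of_ne fun x _ hx h ↦ hx ?_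
  simp [h]

theorem Ncount_eq_mul (q : ℕ) (F : Type*) [Field F] [Fintype F] [Algebra (ZMod q) F]
    (s t : ZMod q) : Ncount q F s t =
    #{a : F | Algebra.trace (ZMod q) F (a ^ 2) = s} *
      #{a : F | Algebra.trace (ZMod q) F (a ^ 2) = t} := by
  rw [Ncount, ← Finset.card_product, Nat.card_eq_fintype_card, Fintype.card_subtype,
    ← Finset.univ_product_univ]
  exact congrArg card (Finset.filter_product
    (fun a : F ↦ Algebra.trace (ZMod q) F (a ^ 2) = s)
    (fun a : F ↦ Algebra.trace (ZMod q) F (a ^ 2) = t))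

/-- In an extension of odd degree, the quadratic character restricts to that of the base field. -/
theorem quadraticChar_algebraMap_of_odd_finrank {K L : Type*} [Field K] [Fintype K]
    [DecidableEq K] [Field L] [Fintype L] [DecidableEq L] [Algebra K L]
    (h : Odd (Module.finrank K L)) (a : K) :
    quadraticChar L (algebraMap K L a) = quadraticChar K a := by
  by_cases ha : a = 0
  · simp [ha]
  have ha' : algebraMap K L a ≠ 0 := by simpa using ha
  have hsq : IsSquare (algebraMap K L a) ↔ IsSquare a := by
    refine ⟨fun ⟨b, hb⟩ ↦ ?_, fun h ↦ h.map _⟩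
    obtain ⟨k, hk⟩ := h
    have hN := congrArg (Algebra.norm K) hb
    rw [Algebra.norm_algebraMap, map_mul, hk] at hN
    refine ⟨Algebra.norm K b / a ^ k, ?_⟩
    field_simp
    rw [sq (Algebra.norm K b), ← hN]
    ring
  rw [quadraticChar_apply, quadraticChar_apply, quadraticCharFun, quadraticCharFun]
  simp only [ha, ha', hsq, if_false]

/-- A quadratic exponential sum over a finite field is a quadratic Gauss sum. -/
theorem AddChar.sum_mul_sq_eq_quadraticChar_mul_gaussSum {F R : Type*} [Field F] [Fintype F]
    [DecidableEq F] [CommRing R] [IsDomain R] (hF : ringChar F ≠ 2) {χ : AddChar F R}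
    (hχ : χ.IsPrimitive) {c : F} (hc : c ≠ 0) :
    ∑ a, χ (c * a ^ 2) =
      (quadraticChar F c : R) * gaussSum ((quadraticChar F).ringHomComp (Int.castRingHom R)) χ := by
  have hfib : ∑ a, χ (c * a ^ 2) = ∑ b, ((quadraticChar F b : R) + 1) * χ (c * b) := by
    rw [← Finset.sum_fiberwise (s := univ) (g := fun a : F ↦ a ^ 2)]
    refine Finset.sum_congr rfl fun b _ ↦ ?_
    have hcard := quadraticChar_card_sqrts hF b
    have hset : {x : F | x ^ 2 = b}.toFinset = univ.filter fun a : F ↦ a ^ 2 = b := by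
      ext; simp
    rw [hset] at hcard
    rw [Finset.sum_congr rfl (g := fun _ ↦ χ (c * b)) (by simp +contextual), Finset.sum_const,
      nsmul_eq_mul]
    congr 1
    exact_mod_cast congrArg (Int.cast : ℤ → R) hcard
  have hzero : ∑ b, χ (c * b) = 0 := AddChar.sum_eq_zero_of_ne_one (hχ hc)
  have hsq : (quadraticChar F c : R) * quadraticChar F c = 1 := by
    rw [← sq]; exact_mod_cast congrArg (Int.cast : ℤ → R) (quadraticChar_sq_one hc)
  have hshift := gaussSum_mulShift ((quadraticChar F).ringHomComp (Int.castRingHom R)) χ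
    (Units.mk0 c hc)
  simp only [MulChar.ringHomComp_apply, Units.val_mk0, eq_intCast] at hshift
  rw [hfib, ← hshift, ← mul_assoc, hsq, one_mul]
  simp [add_mul, Finset.sum_add_distrib, hzero, gaussSum]

section

variable (q : ℕ) [Fact q.Prime] (F : Type*) [Field F] [Algebra (ZMod q) F]

/-- The additive character of `F` obtained from `ZMod.stdAddChar` via the trace. -/
noncomputable def traceAddChar : AddChar F ℂ :=
  ZMod.stdAddChar.compAddMonoidHom (Algebra.trace (ZMod q) F).toAddMonoidHom

theorem traceAddChar_apply (x : F) :
    traceAddChar q F x = ZMod.stdAddChar (Algebra.trace (ZMod q) F x) := rfl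

variable [Fintype F]

theorem traceAddChar_isPrimitive : (traceAddChar q F).IsPrimitive := by
  refine AddChar.IsPrimitive.of_ne_one fun h ↦ ?_
  obtain ⟨x, hx⟩ := Algebra.trace_surjective (ZMod q) F 1
  refine ZMod.isPrimitive_stdAddChar q one_ne_zero (DFunLike.ext _ _ fun y ↦ ?_)
  have := DFunLike.congr_fun h (algebraMap (ZMod q) F y * x)
  rwa [traceAddChar_apply, ← Algebra.smul_def, map_smul, hx, smul_eq_mul, mul_comm] at this

variable [DecidableEq F]

theorem gaussBig_eq_gaussSum : gaussBig q F =
    gaussSum ((quadraticChar F).ringHomComp (Int.castRingHom ℂ)) (traceAddChar q F) := by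
  simp only [gaussBig, gaussSum, zetaQ_eq_stdAddChar, traceAddChar_apply]
  refine Finset.sum_filter_of_ne fun x _ hx h ↦ hx ?_
  simp [h]

/-- The number of `a` in an odd degree extension `F` of `ZMod q` with `Tr(a²) = s`. -/
theorem card_trace_sq_eq (hq : q ≠ 2) (hodd : Odd (Module.finrank (ZMod q) F)) (s : ZMod q) :
    (q : ℂ) * #{a : F | Algebra.trace (ZMod q) F (a ^ 2) = s} =
      Fintype.card F + (quadraticChar (ZMod q) (-s) : ℂ) * gaussBig q F * gaussSmall q := by
  have hcharF : ringChar F ≠ 2 := by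
    rw [← Algebra.ringChar_eq (ZMod q) F, ZMod.ringChar_zmod_n]; exact hq
  have hfourier (a : F) : ∑ y : ZMod q,
      ZMod.stdAddChar (y * (Algebra.trace (ZMod q) F (a ^ 2) - s)) =
        if Algebra.trace (ZMod q) F (a ^ 2) = s then (q : ℂ) else 0 := by
    rw [AddChar.sum_mulShift _ (ZMod.isPrimitive_stdAddChar q), ZMod.card]
    simp only [sub_eq_zero, Nat.cast_ite, Nat.cast_zero]
  have hinner (y : ZMod q) : ∑ a : F,
      ZMod.stdAddChar (y * (Algebra.trace (ZMod q) F (a ^ 2) - s)) =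
        (if y = 0 then (Fintype.card F : ℂ) else 0) +
          gaussBig q F * ((quadraticChar (ZMod q) y : ℂ) * ZMod.stdAddChar (-s * y)) := by
    by_cases hy : y = 0
    · simp [hy]
    have hy' : algebraMap (ZMod q) F y ≠ 0 := by simpa using hy
    have hterm (a : F) : ZMod.stdAddChar (y * (Algebra.trace (ZMod q) F (a ^ 2) - s)) =
        traceAddChar q F (algebraMap (ZMod q) F y * a ^ 2) * ZMod.stdAddChar (-s * y) := by
      rw [traceAddChar_apply, ← Algebra.smul_def, map_smul, ← AddChar.map_add_eq_mul, smul_eq_mul]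
      ring_nf
    rw [Finset.sum_congr rfl fun a _ ↦ hterm a, ← Finset.sum_mul,
      AddChar.sum_mul_sq_eq_quadraticChar_mul_gaussSum hcharF (traceAddChar_isPrimitive q F) hy',
      quadraticChar_algebraMap_of_odd_finrank hodd, ← gaussBig_eq_gaussSum, if_neg hy]
    ring
  have hsmall : ∑ y : ZMod q, (quadraticChar (ZMod q) y : ℂ) * ZMod.stdAddChar (-s * y) =
      (quadraticChar (ZMod q) (-s) : ℂ) * gaussSmall q := by
    by_cases hs : s = 0
    · have := quadraticChar_sum_zero (F := ZMod q) (by rwa [ZMod.ringChar_zmod_n])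
      simpa [hs] using congrArg (Int.cast : ℤ → ℂ) this
    have hs' : -s ≠ 0 := neg_ne_zero.mpr hs
    have hsq : (quadraticChar (ZMod q) (-s) : ℂ) * quadraticChar (ZMod q) (-s) = 1 := by
      rw [← sq]; exact_mod_cast congrArg (Int.cast : ℤ → ℂ) (quadraticChar_sq_one hs')
    have hshift := gaussSum_mulShift ((quadraticChar (ZMod q)).ringHomComp (Int.castRingHom ℂ))
      ZMod.stdAddChar (Units.mk0 (-s) hs')
    simp only [MulChar.ringHomComp_apply, Units.val_mk0, eq_intCast] at hshift
    rw [gaussSmall_eq_gaussSum, ← hshift, ← mul_assoc, hsq, one_mul]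
    simp [gaussSum]
  calc (q : ℂ) * #{a : F | Algebra.trace (ZMod q) F (a ^ 2) = s}
      = ∑ a : F, if Algebra.trace (ZMod q) F (a ^ 2) = s then (q : ℂ) else 0 := by
        rw [← Finset.sum_filter, Finset.sum_const, nsmul_eq_mul, mul_comm]
    _ = ∑ y : ZMod q, ∑ a : F,
          ZMod.stdAddChar (y * (Algebra.trace (ZMod q) F (a ^ 2) - s)) := by
        rw [Finset.sum_comm]
        exact Finset.sum_congr rfl fun a _ ↦ (hfourier a).symm
    _ = _ := by
        rw [Finset.sum_congr rfl fun y _ ↦ hinner y, Finset.sum_add_distrib, ← Finset.mul_sum,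
          hsmall, Finset.sum_ite_eq' univ (0 : ZMod q)]
        simp only [Finset.mem_univ, if_true]
        ring

end

theorem stmt0 (q m : ℕ) [Fact q.Prime] (hq : Odd q) (hm : 2 ≤ m) (hmodd : Odd m)
    (F : Type*) [Field F] [Fintype F] [DecidableEq F] [Algebra (ZMod q) F]
    (hF : Fintype.card F = q ^ m) (s t : ZMod q) :
    (s = 0 ∧ t = 0 → (Ncount q F s t : ℂ) = (q : ℂ) ^ (2 * (m : ℤ) - 2)) ∧
    (s ≠ 0 ∧ t = 0 → (Ncount q F s t : ℂ) = (q : ℂ) ^ (2 * (m : ℤ) - 2) +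
      (q : ℂ) ^ ((m : ℤ) - 2) * (quadraticChar (ZMod q) (-s) : ℂ) *
        gaussBig q F * gaussSmall q) ∧
    (s = 0 ∧ t ≠ 0 → (Ncount q F s t : ℂ) = (q : ℂ) ^ (2 * (m : ℤ) - 2) +
      (q : ℂ) ^ ((m : ℤ) - 2) * (quadraticChar (ZMod q) (-t) : ℂ) *
        gaussBig q F * gaussSmall q) ∧
    (s ≠ 0 ∧ t ≠ 0 → (Ncount q F s t : ℂ) = (q : ℂ) ^ (2 * (m : ℤ) - 2) +
      (q : ℂ) ^ ((m : ℤ) - 2) *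
        ((quadraticChar (ZMod q) (-s) : ℂ) + (quadraticChar (ZMod q) (-t) : ℂ)) *
        gaussBig q F * gaussSmall q +
      (q : ℂ) ^ (-2 : ℤ) * (quadraticChar (ZMod q) (s * t) : ℂ) *
        (gaussBig q F) ^ 2 * (gaussSmall q) ^ 2) := by
  have hqC : (q : ℂ) ≠ 0 := Nat.cast_ne_zero.mpr (Fact.out : q.Prime).ne_zero
  have hq2 : q ≠ 2 := by rintro rfl; exact absurd hq (by decide)
  have hrank : Module.finrank (ZMod q) F = m := by
    have h := Module.card_eq_pow_finrank (K := ZMod q) (V := F)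
    rw [hF, ZMod.card] at h
    exact (Nat.pow_right_injective (Fact.out : q.Prime).two_le h).symm
  have hcard (u : ZMod q) : (#{a : F | Algebra.trace (ZMod q) F (a ^ 2) = u} : ℂ) =
      (q : ℂ) ^ ((m : ℤ) - 1) +
        (q : ℂ)⁻¹ * ((quadraticChar (ZMod q) (-u) : ℂ) * gaussBig q F * gaussSmall q) := by
    have h := card_trace_sq_eq q F hq2 (hrank ▸ hmodd) u
    rw [hF] at h
    rw [zpow_sub_one₀ hqC, zpow_natCast, eq_comm, mul_comm (_ ^ m), ← mul_add,
      inv_mul_eq_iff_eq_mul₀ hqC, h]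
    push_cast
    ring
  have hpow : (q : ℂ) ^ (2 * (m : ℤ) - 2) = (q : ℂ) ^ ((m : ℤ) - 1) * (q : ℂ) ^ ((m : ℤ) - 1) := by
    rw [← zpow_add₀ hqC]; ring_nf
  have hpow' : (q : ℂ) ^ ((m : ℤ) - 2) = (q : ℂ) ^ ((m : ℤ) - 1) * (q : ℂ)⁻¹ := by
    rw [← zpow_sub_one₀ hqC]; ring_nf
  have hpow2 : (q : ℂ) ^ (-2 : ℤ) = (q : ℂ)⁻¹ * (q : ℂ)⁻¹ := by
    rw [← zpow_neg_one, ← zpow_add₀ hqC]; rfl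
  have hmul : (quadraticChar (ZMod q) (s * t) : ℂ) =
      (quadraticChar (ZMod q) (-s) : ℂ) * (quadraticChar (ZMod q) (-t) : ℂ) := by
    rw [← neg_mul_neg, map_mul, Int.cast_mul]
  rw [Ncount_eq_mul, Nat.cast_mul, hcard s, hcard t, hpow, hpow', hpow2, hmul]
  refine ⟨?_, ?_, ?_, ?_⟩
  · rintro ⟨rfl, rfl⟩; simp
  · rintro ⟨-, rfl⟩; simp only [neg_zero, quadraticChar_zero, Int.cast_zero]; ring
  · rintro ⟨rfl, -⟩; simp only [neg_zero, quadraticChar_zero, Int.cast_zero]; ring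
  · rintro -; ring
end

section
/- Let m ≥ 3 be odd. Then the number of pairs (α,β) ∈ 𝔽_{q^m} × 𝔽_{q^m} with W(α,β) = 2(q−1)q^{2m−3} equals (2q−1)q^{2m−2} − 2(q−1)q^{m−1} − 1. -/
open Finset

/-- The defining set `D = {(a,b) ≠ (0,0) : Tr(a²) = 0 and Tr(b²) = 0}`. -/
noncomputable def defSet (q : ℕ) (F : Type*) [Field F] [Fintype F] [DecidableEq F]
    [Algebra (ZMod q) F] : Finset (F × F) :=
  Finset.univ.filter (fun p : F × F => p ≠ (0, 0) ∧
    Algebra.trace (ZMod q) F (p.1 ^ 2) = 0 ∧ Algebra.trace (ZMod q) F (p.2 ^ 2) = 0)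

/-- The Lee weight `W(α,β)` of the codeword of `C_D` corresponding to `x = α + uβ`,
i.e. the Hamming weight of its Gray image. -/
noncomputable def leeW (q : ℕ) (F : Type*) [Field F] [Fintype F] [DecidableEq F]
    [Algebra (ZMod q) F] (α β : F) : ℕ :=
  ((defSet q F).filter
      (fun p => Algebra.trace (ZMod q) F (α * p.1 + β * p.2) ≠ 0)).card +
  ((defSet q F).filter
      (fun p => Algebra.trace (ZMod q) F (β * p.1 + α * p.2) ≠ 0)).card

open AddChar

/-- The quadratic character of a finite field, with values in `ℂ`. -/
noncomputable def complexQuadraticChar (F : Type*) [Field F] [Fintype F] [DecidableEq F] :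
    MulChar F ℂ :=
  (quadraticChar F).ringHomComp (Int.castRingHom ℂ)

lemma complexQuadraticChar_apply {F : Type*} [Field F] [Fintype F] [DecidableEq F] (a : F) :
    complexQuadraticChar F a = (quadraticChar F a : ℂ) := rfl

lemma complexQuadraticChar_ne_one {F : Type*} [Field F] [Fintype F] [DecidableEq F]
    (hF : ringChar F ≠ 2) : complexQuadraticChar F ≠ 1 := by
  obtain ⟨a, ha⟩ := quadraticChar_exists_neg_one' hF
  intro h
  have h1 : complexQuadraticChar F (a : F) = 1 := by rw [h, MulChar.one_apply a.isUnit]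
  rw [complexQuadraticChar_apply, ha] at h1
  norm_num at h1

lemma gaussSum_complexQuadraticChar_ne_zero {F : Type*} [Field F] [Fintype F] [DecidableEq F]
    (hF : ringChar F ≠ 2) {ψ : AddChar F ℂ} (hψ : ψ.IsPrimitive) :
    gaussSum (complexQuadraticChar F) ψ ≠ 0 :=
  gaussSum_ne_zero_of_nontrivial (by exact_mod_cast Fintype.card_ne_zero)
    (complexQuadraticChar_ne_one hF) hψ

lemma complexQuadraticChar_mul_self {F : Type*} [Field F] [Fintype F] [DecidableEq F]
    {a : F} (ha : a ≠ 0) : complexQuadraticChar F a * complexQuadraticChar F a = 1 := by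
  have h := quadraticChar_sq_one ha
  rw [complexQuadraticChar_apply, ← sq]
  exact_mod_cast h

lemma gaussSum_complexQuadraticChar_mulShift {F : Type*} [Field F] [Fintype F] [DecidableEq F]
    (ψ : AddChar F ℂ) {a : F} (ha : a ≠ 0) :
    gaussSum (complexQuadraticChar F) (ψ.mulShift a) =
      complexQuadraticChar F a * gaussSum (complexQuadraticChar F) ψ := by
  have h := gaussSum_mulShift (complexQuadraticChar F) ψ (Units.mk0 a ha)
  rw [Units.val_mk0] at h
  rw [← h, ← mul_assoc, complexQuadraticChar_mul_self ha, one_mul]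

lemma sum_addChar_sq {F : Type*} [Field F] [Fintype F] [DecidableEq F]
    (hF : ringChar F ≠ 2) {ψ : AddChar F ℂ} (hψ : ψ ≠ 1) :
    ∑ a, ψ (a ^ 2) = gaussSum (complexQuadraticChar F) ψ := by
  have h1 : ∑ a, ψ (a ^ 2) = ∑ y : F, ∑ a with a ^ 2 = y, ψ y := by
    rw [← Finset.sum_fiberwise univ (fun a : F => a ^ 2) (fun a => ψ (a ^ 2))]
    refine Finset.sum_congr rfl fun y _ => Finset.sum_congr rfl fun a ha => ?_
    rw [(Finset.mem_filter.mp ha).2]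
  have h2 (y : F) : ((#{a : F | a ^ 2 = y} : ℕ) : ℂ) = complexQuadraticChar F y + 1 := by
    have h := quadraticChar_card_sqrts hF y
    have h' : ({x | x ^ 2 = y} : Set F).toFinset = Finset.univ.filter fun a : F => a ^ 2 = y := by
      ext; simp
    rw [h'] at h
    rw [complexQuadraticChar_apply]
    exact_mod_cast h
  rw [h1]
  simp_rw [Finset.sum_const, nsmul_eq_mul, h2, add_mul, one_mul]
  rw [Finset.sum_add_distrib, AddChar.sum_eq_zero_of_ne_one hψ, add_zero, gaussSum]

lemma sum_addChar_quadratic {F : Type*} [Field F] [Fintype F] [DecidableEq F]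
    (hF : ringChar F ≠ 2) {ψ : AddChar F ℂ} (hψ : ψ.IsPrimitive) {z : F} (hz : z ≠ 0) (α : F) :
    ∑ a, ψ (z * a ^ 2 + α * a) =
      ψ (-(4 * z)⁻¹ * α ^ 2) * (complexQuadraticChar F z *
        gaussSum (complexQuadraticChar F) ψ) := by
  have h2 : (2 : F) ≠ 0 := Ring.two_ne_zero hF
  have h1 (a : F) : z * a ^ 2 + α * a =
      -(4 * z)⁻¹ * α ^ 2 + z * (a + α / (2 * z)) ^ 2 := by
    have : (4 : F) = 2 * 2 := by norm_num
    rw [this]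
    field_simp
    ring
  simp_rw [h1, map_add_eq_mul, ← Finset.mul_sum]
  have hshift := Equiv.sum_comp (Equiv.addRight (α / (2 * z))) (fun a => ψ (z * a ^ 2))
  simp only [Equiv.coe_addRight] at hshift
  rw [hshift,
    ← gaussSum_complexQuadraticChar_mulShift ψ hz, ← sum_addChar_sq hF (hψ hz)]
  simp [mulShift_apply]

lemma quadraticChar_algebraMap_of_odd {K F : Type*} [Field K] [Fintype K] [DecidableEq K]
    [Field F] [Fintype F] [DecidableEq F] [Algebra K F] (hK : ringChar K ≠ 2) {m : ℕ}
    (hm : Odd m) (hF : Fintype.card F = Fintype.card K ^ m) (z : K) :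
    quadraticChar F (algebraMap K F z) = quadraticChar K z := by
  have hchar : ringChar F ≠ 2 := by
    rwa [← Algebra.ringChar_eq K F]
  rcases eq_or_ne z 0 with rfl | hz
  · simp
  have hodd : Odd (Fintype.card K) := by
    rw [Nat.odd_iff]; exact FiniteField.odd_card_of_char_ne_two hK
  obtain ⟨k, hk⟩ := hodd
  have hdiv : Fintype.card F / 2 = k * ∑ i ∈ range m, Fintype.card K ^ i := by
    have h := geom_sum_mul_add (2 * k) m
    rw [hF, hk, ← h]
    have : (∑ i ∈ range m, (2 * k + 1) ^ i) * (2 * k) =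
      2 * (k * ∑ i ∈ range m, (2 * k + 1) ^ i) := by ring
    omega
  have hsum : Odd (∑ i ∈ range m, Fintype.card K ^ i) := by
    rw [Finset.odd_sum_iff_odd_card_odd]
    have : {i ∈ range m | Odd (Fintype.card K ^ i)} = range m :=
      Finset.filter_true_of_mem fun i _ => Odd.pow ⟨k, hk⟩
    rwa [this, card_range]
  have hkdiv : Fintype.card K / 2 = k := by omega
  have h0 : algebraMap K F z ≠ 0 := by simpa using hz
  rw [quadraticChar_eq_pow_of_char_ne_two hchar h0, quadraticChar_eq_pow_of_char_ne_two hK hz,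
    hdiv, hkdiv, pow_mul, ← map_pow, ← map_pow]
  have hne : (-1 : K) ≠ 1 := Ring.neg_one_ne_one_of_char_ne_two hK
  have hdich := FiniteField.pow_dichotomy hK hz
  rw [hkdiv] at hdich
  rcases hdich with h | h
  · simp [h]
  · rw [h, hsum.neg_one_pow]
    simp [hne, Ring.neg_one_ne_one_of_char_ne_two hchar]

section TraceForm

variable {q : ℕ} [Fact q.Prime] {F : Type*} [Field F] [Algebra (ZMod q) F]

/-- The pullback of an additive character along the absolute trace. -/
noncomputable def traceChar (F : Type*) [Field F] [Algebra (ZMod q) F]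
    (χ : AddChar (ZMod q) ℂ) : AddChar F ℂ :=
  χ.compAddMonoidHom (Algebra.trace (ZMod q) F).toAddMonoidHom

lemma traceChar_apply (χ : AddChar (ZMod q) ℂ) (a : F) :
    traceChar F χ a = χ (Algebra.trace (ZMod q) F a) := rfl

lemma traceChar_isPrimitive [Finite F] {χ : AddChar (ZMod q) ℂ} (hχ : χ.IsPrimitive) :
    (traceChar F χ).IsPrimitive := by
  refine IsPrimitive.of_ne_one fun h => ?_
  obtain ⟨t, ht⟩ := ne_one_iff.mp (hχ one_ne_zero)
  obtain ⟨a, ha⟩ := Algebra.trace_surjective (ZMod q) F t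
  apply ht
  have := DFunLike.congr_fun h a
  rw [traceChar_apply, ha] at this
  simpa [mulShift_apply] using this

variable [Fintype F]

/-- The isotropic vectors of the trace form. -/
noncomputable def isotropicSet (q : ℕ) (F : Type*) [Field F] [Fintype F]
    [Algebra (ZMod q) F] : Finset F :=
  Finset.univ.filter fun a => Algebra.trace (ZMod q) F (a ^ 2) = 0

lemma mem_isotropicSet {a : F} :
    a ∈ isotropicSet q F ↔ Algebra.trace (ZMod q) F (a ^ 2) = 0 := by
  simp [isotropicSet]

/-- The Fourier transform of the indicator function of the isotropic vectors. -/
noncomputable def isotropicSum (χ : AddChar (ZMod q) ℂ) (α : F) : ℂ :=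
  ∑ a ∈ isotropicSet q F, traceChar F χ (α * a)

lemma isotropicSum_zero (χ : AddChar (ZMod q) ℂ) :
    isotropicSum χ (0 : F) = (isotropicSet q F).card := by
  simp [isotropicSum]

lemma isotropicSum_smul (χ : AddChar (ZMod q) ℂ) {y : ZMod q} (hy : y ≠ 0) (α : F) :
    isotropicSum χ (y • α) = isotropicSum χ α := by
  have hy' : algebraMap (ZMod q) F y ≠ 0 := by simpa using hy
  refine Finset.sum_bijective (fun a => y • a) ?_ ?_ ?_
  · simp_rw [Algebra.smul_def]
    exact mulLeft_bijective₀ _ hy'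
  · intro a
    simp [mem_isotropicSet, smul_pow, hy]
  · intro a _
    simp

lemma sum_addChar_mul (χ : AddChar (ZMod q) ℂ) (hχ : χ.IsPrimitive) (t : ZMod q) :
    ∑ z, χ (z * t) = if t = 0 then (q : ℂ) else 0 := by
  rw [sum_mulShift t hχ, ZMod.card]
  split_ifs <;> simp

lemma mul_card_orthogonal_isotropic {χ : AddChar (ZMod q) ℂ} (hχ : χ.IsPrimitive) (α β : F) :
    (q : ℂ) * (((isotropicSet q F ×ˢ isotropicSet q F).filter fun p =>
        Algebra.trace (ZMod q) F (α * p.1 + β * p.2) = 0).card : ℂ) =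
      ((isotropicSet q F).card : ℂ) ^ 2 +
        (q - 1) * (isotropicSum χ α * isotropicSum χ β) := by
  have hq0 : 0 < q := (Fact.out : q.Prime).pos
  have h1 : (q : ℂ) * (((isotropicSet q F ×ˢ isotropicSet q F).filter fun p =>
        Algebra.trace (ZMod q) F (α * p.1 + β * p.2) = 0).card : ℂ) =
      ∑ y : ZMod q, isotropicSum χ (y • α) * isotropicSum χ (y • β) := by
    simp_rw [isotropicSum, Finset.sum_mul_sum, ← Finset.sum_product', ← map_add_eq_mul]
    rw [Finset.sum_product_right]
    simp_rw [smul_mul_assoc, ← smul_add, traceChar_apply, map_smul, smul_eq_mul,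
      sum_addChar_mul χ hχ]
    rw [← Finset.sum_filter, Finset.sum_const, nsmul_eq_mul, mul_comm]
  rw [h1, ← Finset.add_sum_erase _ _ (Finset.mem_univ (0 : ZMod q)), zero_smul, zero_smul,
    isotropicSum_zero, sq]
  congr 1
  rw [Finset.sum_congr rfl fun y hy => by
    rw [isotropicSum_smul χ (Finset.ne_of_mem_erase hy),
      isotropicSum_smul χ (Finset.ne_of_mem_erase hy)], Finset.sum_const,
    Finset.card_erase_of_mem (Finset.mem_univ _), Finset.card_univ, ZMod.card, nsmul_eq_mul,
    Nat.cast_sub hq0, Nat.cast_one]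

variable [DecidableEq F]

lemma mul_isotropicSum {m : ℕ} (hq : q ≠ 2) (hm : Odd m) (hF : Fintype.card F = q ^ m)
    {χ : AddChar (ZMod q) ℂ} (hχ : χ.IsPrimitive) (α : F) :
    q * isotropicSum χ α = (if α = 0 then (q : ℂ) ^ m else 0) +
      gaussSum (complexQuadraticChar F) (traceChar F χ) *
        (complexQuadraticChar (ZMod q) (-1) *
          gaussSum (complexQuadraticChar (ZMod q))
            (χ.mulShift (Algebra.trace (ZMod q) F (α ^ 2)))) := by
  have hK : ringChar (ZMod q) ≠ 2 := by rwa [ZMod.ringChar_zmod_n]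
  have hchar : ringChar F ≠ 2 := by rwa [← Algebra.ringChar_eq (ZMod q) F]
  have hψ := traceChar_isPrimitive (F := F) hχ
  set G := gaussSum (complexQuadraticChar F) (traceChar F χ)
  have h4 : (4 : ZMod q) ≠ 0 := by
    have h2 : (2 : ZMod q) ≠ 0 := Ring.two_ne_zero hK
    have : (4 : ZMod q) = 2 * 2 := by norm_num
    rw [this]; exact mul_ne_zero h2 h2
  have h1 : q * isotropicSum χ α =
      ∑ z : ZMod q, ∑ a : F, traceChar F χ (algebraMap (ZMod q) F z * a ^ 2 + α * a) := by
    rw [Finset.sum_comm]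
    simp_rw [map_add_eq_mul, ← Finset.sum_mul, traceChar_apply, ← Algebra.smul_def, map_smul,
      smul_eq_mul, sum_addChar_mul χ hχ, ite_mul, zero_mul]
    rw [← Finset.sum_filter, isotropicSum, isotropicSet, Finset.mul_sum]
    rfl
  have hzero : ∑ a : F, traceChar F χ (α * a) = if α = 0 then (q : ℂ) ^ m else 0 := by
    simp_rw [mul_comm α]
    rw [sum_mulShift α hψ, hF]
    split_ifs <;> simp
  have hterm (z : ZMod q) :
      ∑ a : F, traceChar F χ (algebraMap (ZMod q) F z * a ^ 2 + α * a) =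
      (if z = 0 then (if α = 0 then (q : ℂ) ^ m else 0) else 0) +
        G * (complexQuadraticChar (ZMod q) (-1) * (complexQuadraticChar (ZMod q) (-(4 * z)⁻¹) *
          χ.mulShift (Algebra.trace (ZMod q) F (α ^ 2)) (-(4 * z)⁻¹))) := by
    rcases eq_or_ne z 0 with rfl | hz
    · simpa [MulChar.map_zero] using hzero
    have hz' : algebraMap (ZMod q) F z ≠ 0 := by simpa using hz
    have hquad : complexQuadraticChar F (algebraMap (ZMod q) F z) =
        complexQuadraticChar (ZMod q) (-1) * complexQuadraticChar (ZMod q) (-(4 * z)⁻¹) := by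
      rw [complexQuadraticChar_apply,
        quadraticChar_algebraMap_of_odd hK hm (by rw [hF, ZMod.card]), ← map_mul,
        ← complexQuadraticChar_apply]
      have : z = (-1 * -(4 * z)⁻¹) * ((2 * z) * (2 * z)) := by
        field_simp
        norm_num
      have h2z : 2 * z ≠ 0 := mul_ne_zero (Ring.two_ne_zero hK) hz
      conv_lhs => rw [this]
      rw [map_mul, map_mul _ (2 * z), complexQuadraticChar_mul_self h2z, mul_one]
    have harg : traceChar F χ (-(4 * algebraMap (ZMod q) F z)⁻¹ * α ^ 2) =
        χ.mulShift (Algebra.trace (ZMod q) F (α ^ 2)) (-(4 * z)⁻¹) := by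
      have : -(4 * algebraMap (ZMod q) F z)⁻¹ * α ^ 2 = (-(4 * z)⁻¹) • α ^ 2 := by
        rw [Algebra.smul_def, map_neg, map_inv₀, map_mul, map_ofNat]
      rw [this, traceChar_apply, map_smul, mulShift_apply, smul_eq_mul, mul_comm]
    rw [sum_addChar_quadratic hchar hψ hz', hquad, harg, if_neg hz]
    ring
  have hinv : Function.Involutive fun z : ZMod q => -(4 * z)⁻¹ := by
    intro z
    rcases eq_or_ne z 0 with rfl | hz
    · simp
    · field_simp
  rw [h1, Finset.sum_congr rfl fun z _ => hterm z, Finset.sum_add_distrib, ← Finset.mul_sum,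
    ← Finset.mul_sum, gaussSum]
  congr 1
  · simp
  · congr 2
    exact Equiv.sum_comp hinv.toPerm fun t => complexQuadraticChar (ZMod q) t *
      χ.mulShift (Algebra.trace (ZMod q) F (α ^ 2)) t

lemma isotropicSum_eq_zero_iff {m : ℕ} (hq : q ≠ 2) (hm : Odd m)
    (hF : Fintype.card F = q ^ m) {χ : AddChar (ZMod q) ℂ} (hχ : χ.IsPrimitive) (α : F) :
    isotropicSum χ α = 0 ↔ α ∈ (isotropicSet q F).erase 0 := by
  have hK : ringChar (ZMod q) ≠ 2 := by rwa [ZMod.ringChar_zmod_n]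
  have hchar : ringChar F ≠ 2 := by rwa [← Algebra.ringChar_eq (ZMod q) F]
  have hq0 : (q : ℂ) ≠ 0 := by exact_mod_cast (Fact.out : q.Prime).ne_zero
  have hmain := mul_isotropicSum hq hm hF hχ α
  rw [Finset.mem_erase, mem_isotropicSet, ← mul_right_inj' hq0, mul_zero, hmain]
  by_cases hT : Algebra.trace (ZMod q) F (α ^ 2) = 0
  · rw [hT, mulShift_zero, gaussSum_one_right (complexQuadraticChar_ne_one hK)]
    simp [hq0]
  · have hα : α ≠ 0 := by rintro rfl; simp at hT
    have h1 : complexQuadraticChar (ZMod q) (-1) ≠ 0 :=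
      left_ne_zero_of_mul_eq_one (complexQuadraticChar_mul_self (neg_ne_zero.mpr one_ne_zero))
    rw [gaussSum_complexQuadraticChar_mulShift χ hT]
    simp [hT, hα, h1, left_ne_zero_of_mul_eq_one (complexQuadraticChar_mul_self hT),
      gaussSum_complexQuadraticChar_ne_zero hK hχ,
      gaussSum_complexQuadraticChar_ne_zero hchar (traceChar_isPrimitive (F := F) hχ)]

lemma card_isotropicSet {m : ℕ} (hq : q ≠ 2) (hm : Odd m) (hF : Fintype.card F = q ^ m) :
    (isotropicSet q F).card = q ^ (m - 1) := by
  have hK : ringChar (ZMod q) ≠ 2 := by rwa [ZMod.ringChar_zmod_n]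
  have hq0 : 0 < q := (Fact.out : q.Prime).pos
  have h := mul_isotropicSum hq hm hF (ZMod.isPrimitive_stdAddChar q) (0 : F)
  rw [isotropicSum_zero, zero_pow two_ne_zero, map_zero, mulShift_zero,
    gaussSum_one_right (complexQuadraticChar_ne_one hK), if_pos rfl, mul_zero, mul_zero,
    add_zero] at h
  have h' : q * (isotropicSet q F).card = q ^ m := by exact_mod_cast h
  obtain ⟨k, rfl⟩ : ∃ k, m = k + 1 := ⟨m - 1, by have := hm.pos; omega⟩
  rw [pow_succ', Nat.mul_right_inj hq0.ne'] at h'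
  simpa using h'

lemma card_defSet_filter_add (α β : F) :
    ((defSet q F).filter
      fun p => Algebra.trace (ZMod q) F (α * p.1 + β * p.2) ≠ 0).card +
    ((isotropicSet q F ×ˢ isotropicSet q F).filter fun p =>
        Algebra.trace (ZMod q) F (α * p.1 + β * p.2) = 0).card =
      (isotropicSet q F).card ^ 2 := by
  have h : (defSet q F).filter
      (fun p => Algebra.trace (ZMod q) F (α * p.1 + β * p.2) ≠ 0) =
      (isotropicSet q F ×ˢ isotropicSet q F).filter
        fun p => ¬ Algebra.trace (ZMod q) F (α * p.1 + β * p.2) = 0 := by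
    ext ⟨a, b⟩
    simp only [defSet, isotropicSet, Finset.mem_filter, Finset.mem_product, Finset.mem_univ,
      true_and]
    constructor
    · tauto
    · rintro ⟨hab, hne⟩
      refine ⟨⟨?_, hab⟩, hne⟩
      rintro ⟨⟩
      simp at hne
  rw [h, add_comm, Finset.card_filter_add_card_filter_not, Finset.card_product, sq]

lemma mul_leeW {χ : AddChar (ZMod q) ℂ} (hχ : χ.IsPrimitive) (α β : F) :
    (q : ℂ) * leeW q F α β = 2 * (q - 1) *
      (((isotropicSet q F).card : ℂ) ^ 2 - isotropicSum χ α * isotropicSum χ β) := by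
  have h1 := mul_card_orthogonal_isotropic hχ α β
  have h2 := mul_card_orthogonal_isotropic hχ β α
  have h3 := congrArg (Nat.cast (R := ℂ)) (card_defSet_filter_add (q := q) α β)
  have h4 := congrArg (Nat.cast (R := ℂ)) (card_defSet_filter_add (q := q) β α)
  push_cast at h3 h4
  rw [leeW]
  push_cast
  linear_combination q * h3 + q * h4 - h1 - h2

lemma leeW_eq_iff {m : ℕ} (hq : q ≠ 2) (hm : Odd m) (hm3 : 3 ≤ m)
    (hF : Fintype.card F = q ^ m) (α β : F) :
    leeW q F α β = 2 * (q - 1) * q ^ (2 * m - 3) ↔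
      α ∈ (isotropicSet q F).erase 0 ∨ β ∈ (isotropicSet q F).erase 0 := by
  have hq1 : 1 < q := (Fact.out : q.Prime).one_lt
  have hq0 : (q : ℂ) ≠ 0 := by exact_mod_cast (Fact.out : q.Prime).ne_zero
  have hq1' : (q : ℂ) - 1 ≠ 0 := by
    rw [sub_ne_zero]; exact_mod_cast hq1.ne'
  have hχ : (ZMod.stdAddChar (N := q)).IsPrimitive := ZMod.isPrimitive_stdAddChar q
  have hL := mul_leeW (χ := ZMod.stdAddChar) hχ α β
  rw [card_isotropicSet hq hm hF] at hL
  have hpow : (((q ^ (m - 1) : ℕ) : ℂ)) ^ 2 = q * q ^ (2 * m - 3) := by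
    push_cast
    rw [← pow_mul, ← pow_succ']
    congr 1
    omega
  rw [hpow] at hL
  rw [← isotropicSum_eq_zero_iff hq hm hF hχ, ← isotropicSum_eq_zero_iff hq hm hF hχ,
    ← mul_eq_zero, ← Nat.cast_inj (R := ℂ), ← mul_right_inj' hq0, hL]
  push_cast [hq1.le]
  constructor
  · intro h
    have h' : 2 * ((q : ℂ) - 1) *
        (isotropicSum (ZMod.stdAddChar (N := q)) α *
          isotropicSum (ZMod.stdAddChar (N := q)) β) = 0 := by
      linear_combination -h
    exact (mul_eq_zero.mp h').resolve_left (mul_ne_zero two_ne_zero hq1')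
  · intro h
    rw [h]
    ring

end TraceForm

lemma card_filter_fst_mem_or_snd_mem {α : Type*} [Fintype α] [DecidableEq α] (s : Finset α) :
    ((Finset.univ.filter fun p : α × α => p.1 ∈ s ∨ p.2 ∈ s).card : ℤ) =
      (Fintype.card α : ℤ) ^ 2 - ((Fintype.card α : ℤ) - s.card) ^ 2 := by
  have h : (Finset.univ.filter fun p : α × α => p.1 ∈ s ∨ p.2 ∈ s) = (sᶜ ×ˢ sᶜ)ᶜ := by
    ext p
    simp only [Finset.mem_filter, Finset.mem_univ, true_and, Finset.mem_compl,
      Finset.mem_product]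
    tauto
  rw [h, Finset.card_compl, Nat.cast_sub (Finset.card_le_univ _), Finset.card_product,
    Fintype.card_prod, Finset.card_compl]
  push_cast [Finset.card_le_univ s]
  ring

theorem stmt8 (q m : ℕ) [Fact q.Prime] (hq : Odd q) (hm : 3 ≤ m) (hmodd : Odd m)
    (F : Type*) [Field F] [Fintype F] [DecidableEq F] [Algebra (ZMod q) F]
    (hF : Fintype.card F = q ^ m) :
    ((Finset.univ.filter (fun p : F × F =>
        leeW q F p.1 p.2 = 2 * (q - 1) * q ^ (2 * m - 3))).card : ℤ) =
      (2 * (q : ℤ) - 1) * (q : ℤ) ^ (2 * m - 2) -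
        2 * ((q : ℤ) - 1) * (q : ℤ) ^ (m - 1) - 1 := by
  have hq2 : q ≠ 2 := by rintro rfl; exact absurd hq (by decide)
  have hcard : ((isotropicSet q F).erase 0).card + 1 = q ^ (m - 1) := by
    rw [Finset.card_erase_add_one (by simp [mem_isotropicSet]),
      card_isotropicSet hq2 hmodd hF]
  have hcard' : (((isotropicSet q F).erase 0).card : ℤ) = (q : ℤ) ^ (m - 1) - 1 := by
    rw [eq_sub_iff_add_eq]; exact_mod_cast hcard
  simp_rw [leeW_eq_iff hq2 hmodd hm hF]
  rw [card_filter_fst_mem_or_snd_mem, hcard', hF]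
  obtain ⟨k, rfl⟩ : ∃ k, m = k + 1 := ⟨m - 1, by omega⟩
  have hexp : 2 * (k + 1) - 2 = 2 * k := by omega
  rw [hexp, Nat.add_sub_cancel]
  push_cast
  ring
end
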